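/- Under the flotation setup with γ of class C³ and det(γ'(s), γ'(t(s))) ≠ 0 for all s, let z(s) = γ(s) + (det(c(s), γ'(t(s))) / det(γ'(s), γ'(t(s))))·γ'(s) be the intersection of the tangent lines to γ at the endpoints of the chord of flotation, let đ = (3/2)·δ, and let D(s) = det(r₂'(s), r₂''(s)). Then the second derivative of the buoyancy curve with respect to its affine arc length parameter, namely r₂''_aff(s) = r₂''(s)·D(s)^{−2/3} − (1/3)·r₂'(s)·D(s)^{−5/3}·det(r₂'(s), r₂'''(s)), satisfies r₂''_aff(s) = (8·đ^{1/3} / ‖c(s)‖³) · (r₁(s) − z(s)). In particular, the affine normal to the buoyancy curve at r₂(s) is parallel to the affine bisector of the chord of flotation (the median of the tangent triangle from the vertex z(s)). -/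

import Mathlib

open Real MeasureTheory intervalIntegral

noncomputable section

/-- The Euclidean plane. -/
abbrev R2 := EuclideanSpace ℝ (Fin 2)

/-- The planar determinant `det(u,v) = u₁v₂ − u₂v₁`. -/
def det2 (u v : R2) : ℝ := u 0 * v 1 - u 1 * v 0

/-- The flotation curve `r₁(s) = (γ(s) + γ(t(s)))/2`. -/
def flotCurve (γ : ℝ → R2) (t : ℝ → ℝ) (s : ℝ) : R2 := ((1:ℝ)/2) • (γ s + γ (t s))

/-- The buoyancy (centroid) curve
`r₂(s) = γ(s) + (1/(3δ))·∫_s^{t(s)} det(γ(u) − γ(s), γ'(u))·(γ(u) − γ(s)) du`. -/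
def buoyCurve (γ : ℝ → R2) (t : ℝ → ℝ) (δ : ℝ) (s : ℝ) : R2 :=
  γ s + (1/(3*δ)) • ∫ u in s..t s, det2 (γ u - γ s) (deriv γ u) • (γ u - γ s)

/-- The intersection point of the tangent lines to `γ` at `γ(s)` and `γ(t(s))`. -/
def tangentPole (γ : ℝ → R2) (t : ℝ → ℝ) (s : ℝ) : R2 :=
  γ s + (det2 (γ (t s) - γ s) (deriv γ (t s)) / det2 (deriv γ s) (deriv γ (t s))) • deriv γ s

theorem HasDerivAt.apply_euclidean {f : ℝ → R2} {f' : R2} {s : ℝ} (hf : HasDerivAt f f' s)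
    (i : Fin 2) : HasDerivAt (fun x => f x i) (f' i) s :=
  (EuclideanSpace.proj i : R2 →L[ℝ] ℝ).hasFDerivAt.comp_hasDerivAt s hf

theorem HasDerivAt.det2 {f g : ℝ → R2} {f' g' : R2} {s : ℝ} (hf : HasDerivAt f f' s)
    (hg : HasDerivAt g g' s) :
    HasDerivAt (fun x => det2 (f x) (g x)) (det2 f' (g s) + det2 (f s) g') s := by
  have h := ((hf.apply_euclidean 0).mul (hg.apply_euclidean 1)).sub
    ((hf.apply_euclidean 1).mul (hg.apply_euclidean 0))
  refine h.congr_deriv ?_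
  simp only [_root_.det2]
  ring

theorem ContDiff.det2 {n : WithTop ℕ∞} {f g : ℝ → R2} (hf : ContDiff ℝ n f)
    (hg : ContDiff ℝ n g) : ContDiff ℝ n (fun x => det2 (f x) (g x)) := by
  rw [contDiff_euclidean] at hf hg
  exact ((hf 0).mul (hg 1)).sub ((hf 1).mul (hg 0))

/-- If `r' = l • c` and `det (c, c') = κ l` with `κ, l > 0`, then the second derivative of `r`
with respect to affine arc length is `κ ^ (-2/3) l⁻¹ c'`. -/
theorem affine_second_deriv_of_deriv_eq_smul {r c : ℝ → R2} {l : ℝ → ℝ} {κ : ℝ} (hκ : 0 < κ)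
    (hl : ∀ s, 0 < l s) (hlc : ContDiff ℝ 2 l) (hc : ContDiff ℝ 2 c)
    (hr : deriv r = fun s => l s • c s) (hdet : ∀ s, det2 (c s) (deriv c s) = κ * l s) (s : ℝ) :
    (det2 (deriv r s) (deriv (deriv r) s) ^ (-(2:ℝ)/3)) • deriv (deriv r) s -
        ((1/3) * det2 (deriv r s) (deriv (deriv r) s) ^ (-(5:ℝ)/3) *
            det2 (deriv r s) (deriv (deriv (deriv r)) s)) • deriv r s =
      (κ ^ (-(2:ℝ)/3) / l s) • deriv c s := by
  have hl' : ContDiff ℝ 1 (deriv l) := hlc.deriv'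
  have hc' : ContDiff ℝ 1 (deriv c) := hc.deriv'
  have dl (s) : HasDerivAt l (deriv l s) s := (hlc.differentiable (by norm_num) s).hasDerivAt
  have dc (s) : HasDerivAt c (deriv c s) s := (hc.differentiable (by norm_num) s).hasDerivAt
  have dl' (s) : HasDerivAt (deriv l) (deriv (deriv l) s) s :=
    (hl'.differentiable (by norm_num) s).hasDerivAt
  have dc' (s) : HasDerivAt (deriv c) (deriv (deriv c) s) s :=
    (hc'.differentiable (by norm_num) s).hasDerivAt
  have hr2 : deriv (deriv r) = fun s => l s • deriv c s + deriv l s • c s := by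
    funext s
    rw [hr]
    exact ((dl s).smul (dc s)).deriv
  have hr3 : deriv (deriv (deriv r)) s = (l s • deriv (deriv c) s + deriv l s • deriv c s) +
      (deriv l s • deriv c s + deriv (deriv l) s • c s) := by
    rw [hr2]
    exact (((dl s).smul (dc' s)).add ((dl' s).smul (dc s))).deriv
  have hdet' : det2 (c s) (deriv (deriv c) s) = κ * deriv l s := by
    have h1 := (dc s).det2 (dc' s)
    rw [funext hdet] at h1
    have h2 := h1.unique ((dl s).const_mul κ)
    rw [← h2]
    simp only [det2]
    ring
  have hls := hl s
  have hD : det2 (deriv r s) (deriv (deriv r) s) = κ * l s ^ 3 := by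
    have h := hdet s
    rw [hr2, hr]
    simp only [det2, PiLp.add_apply, PiLp.smul_apply, smul_eq_mul] at h ⊢
    linear_combination l s ^ 2 * h
  have hE : det2 (deriv r s) (deriv (deriv (deriv r)) s) = 3 * κ * l s ^ 2 * deriv l s := by
    have h := hdet s
    rw [hr3, hr]
    simp only [det2, PiLp.add_apply, PiLp.smul_apply, smul_eq_mul] at h hdet' ⊢
    linear_combination l s ^ 2 * hdet' + 2 * l s * deriv l s * h
  have hp : (κ * l s ^ 3) ^ (-(2:ℝ)/3) = κ ^ (-(2:ℝ)/3) / l s ^ 2 := by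
    have h : (l s ^ 3) ^ (-(2:ℝ)/3) = (l s ^ 2)⁻¹ := by
      rw [← Real.rpow_natCast, ← Real.rpow_natCast, ← Real.rpow_mul hls.le, ← Real.rpow_neg hls.le]
      norm_num
    rw [Real.mul_rpow hκ.le (by positivity), h, ← div_eq_mul_inv]
  have hp' : (κ * l s ^ 3) ^ (-(5:ℝ)/3) = κ ^ (-(2:ℝ)/3) / l s ^ 2 / (κ * l s ^ 3) := by
    rw [← hp, ← Real.rpow_sub_one (by positivity)]
    norm_num
  rw [hD, hE, hp, hp', hr2, hr]
  ext i
  simp only [PiLp.add_apply, PiLp.sub_apply, PiLp.smul_apply, smul_eq_mul]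
  field_simp
  ring

/-- For a positively oriented regular parametrization of the boundary of a planar convex body, the
body lies to the left of each tangent line. -/
theorem det2_deriv_sub_nonneg_of_frontier_eq_range {γ : ℝ → R2} {L : ℝ} (hL : 0 < L)
    (hγ : ContDiff ℝ 1 γ) (hper : γ L = γ 0) (hreg : ∀ s, deriv γ s ≠ 0)
    (hor : 0 < ∫ s in (0:ℝ)..L, det2 (γ s) (deriv γ s))
    {K : Set R2} (hKconv : Convex ℝ K) (hKcl : IsClosed K)
    (hKint : (interior K).Nonempty) (hKbd : frontier K = Set.range γ) (s u : ℝ) :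
    0 ≤ det2 (deriv γ s) (γ u - γ s) := by
  obtain ⟨x, hx⟩ := hKint
  have dγ (s) : HasDerivAt γ (deriv γ s) s := (hγ.differentiable (by norm_num) s).hasDerivAt
  have hγ' : ContDiff ℝ 0 (deriv γ) := hγ.deriv'
  have hγ0 : ContDiff ℝ 0 γ := hγ.of_le (by norm_num)
  have hmem (s) : γ s ∈ frontier K := hKbd ▸ Set.mem_range_self s
  have hsupp (s : ℝ) : ∃ k : ℝ, (∀ a ∈ interior K, k * det2 (deriv γ s) (a - γ s) < 0) ∧
      ∀ a ∈ K, k * det2 (deriv γ s) (a - γ s) ≤ 0 := by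
    obtain ⟨f, hf⟩ := geometric_hahn_banach_open_point hKconv.interior isOpen_interior (hmem s).2
    have hfK : ∀ a ∈ K, f a ≤ f (γ s) := by
      intro a ha
      have hcl : a ∈ closure (interior K) := by
        rw [hKconv.closure_interior_eq_closure_of_nonempty_interior ⟨x, hx⟩]
        exact subset_closure ha
      exact closure_minimal (fun b hb => (hf b hb).le)
        (isClosed_le f.continuous continuous_const) hcl
    have hmax : IsLocalMax (fun v => f (γ v)) s :=
      Filter.Eventually.of_forall fun v => hfK _ (hKcl.frontier_subset (hmem v))
    have hf0 : f (deriv γ s) = 0 :=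
      hmax.hasDerivAt_eq_zero (f.hasFDerivAt.comp_hasDerivAt s (dγ s))
    have hcoord (v : R2) :
        f v = v 0 * f (EuclideanSpace.single 0 1) + v 1 * f (EuclideanSpace.single 1 1) := by
      have hv : v = v 0 • EuclideanSpace.single 0 (1:ℝ) + v 1 • EuclideanSpace.single 1 (1:ℝ) := by
        ext i
        fin_cases i <;> simp
      conv_lhs => rw [hv]
      simp
    set a₀ := f (EuclideanSpace.single 0 1)
    set a₁ := f (EuclideanSpace.single 1 1)
    set d := deriv γ s with hd
    have hdpos : 0 < d 0 ^ 2 + d 1 ^ 2 := by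
      by_contra! hle
      refine hreg s ?_
      rw [← hd]
      ext i
      have h0 : d 0 = 0 := by nlinarith [sq_nonneg (d 0), sq_nonneg (d 1)]
      have h1 : d 1 = 0 := by nlinarith [sq_nonneg (d 0), sq_nonneg (d 1)]
      fin_cases i
      · exact h0
      · exact h1
    have hk (a : R2) : (d 0 * a₁ - d 1 * a₀) * det2 d (a - γ s) =
        (d 0 ^ 2 + d 1 ^ 2) * (f a - f (γ s)) := by
      rw [hcoord] at hf0
      rw [hcoord a, hcoord (γ s)]
      simp only [det2, PiLp.sub_apply]
      linear_combination
        (-(d 0 * (a 0 - γ s 0) + d 1 * (a 1 - γ s 1))) * hf0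
    refine ⟨d 0 * a₁ - d 1 * a₀, fun a ha => ?_, fun a ha => ?_⟩
    · rw [hk]
      nlinarith [hf a ha]
    · rw [hk]
      nlinarith [hfK a ha]
  set φ : ℝ → ℝ := fun s => det2 (deriv γ s) (x - γ s) with hφ
  have hφc : Continuous φ := (hγ'.det2 (contDiff_const.sub hγ0)).continuous
  have hφ0 (s) : φ s ≠ 0 := by
    obtain ⟨k, hk, -⟩ := hsupp s
    intro h
    have := hk x hx
    rw [show det2 (deriv γ s) (x - γ s) = 0 from h] at this
    simp at this
  have hφint : ∫ v in (0:ℝ)..L, φ v = ∫ v in (0:ℝ)..L, det2 (γ v) (deriv γ v) := by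
    have h0 : ∫ v in (0:ℝ)..L, det2 x (deriv γ v) = det2 x (γ L) - det2 x (γ 0) := by
      refine integral_eq_sub_of_hasDerivAt (f := fun v => det2 x (γ v)) (fun v _ => ?_) ?_
      · refine ((hasDerivAt_const v x).det2 (dγ v)).congr_deriv ?_
        simp [det2]
      · exact (contDiff_const.det2 hγ').continuous.intervalIntegrable _ _
    have h1 : ∫ v in (0:ℝ)..L, φ v =
        ∫ v in (0:ℝ)..L, (det2 (γ v) (deriv γ v) - det2 x (deriv γ v)) := by
      congr 1
      funext v
      simp only [hφ, det2, PiLp.sub_apply]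
      ring
    rw [h1, intervalIntegral.integral_sub
      ((hγ0.det2 hγ').continuous.intervalIntegrable _ _)
      ((contDiff_const.det2 hγ').continuous.intervalIntegrable _ _), h0, hper]
    simp
  have hφpos (s) : 0 < φ s := by
    by_contra! hs
    have hneg : ∀ v, φ v < 0 := by
      intro v
      by_contra! hv
      obtain ⟨w, hw⟩ := mem_range_of_exists_le_of_exists_ge hφc ⟨s, hs⟩ ⟨v, hv⟩
      exact hφ0 w hw
    have := intervalIntegral.integral_nonneg (μ := volume) hL.le
      (f := fun v => -φ v) fun v _ => (neg_pos.2 (hneg v)).le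
    rw [intervalIntegral.integral_neg, hφint] at this
    linarith
  obtain ⟨k, hk, hkK⟩ := hsupp s
  have h1 := hk x hx
  have h2 := hkK (γ u) (hKcl.frontier_subset (hmem u))
  have h3 : 0 < det2 (deriv γ s) (x - γ s) := hφpos s
  have hkneg : k < 0 := by
    by_contra! h
    nlinarith
  by_contra! h
  nlinarith

/-- The area of the segment cut off by a chord, in terms of a primitive of `det (γ, γ')`. -/
theorem integral_det2_sub_deriv {γ : ℝ → R2} (hγ : ContDiff ℝ 1 γ) (a b : ℝ) :
    ∫ u in a..b, det2 (γ u - γ a) (deriv γ u) =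
      (∫ u in (0:ℝ)..b, det2 (γ u) (deriv γ u)) - (∫ u in (0:ℝ)..a, det2 (γ u) (deriv γ u)) -
        det2 (γ a) (γ b) := by
  have dγ (s) : HasDerivAt γ (deriv γ s) s := (hγ.differentiable (by norm_num) s).hasDerivAt
  have hγ' : ContDiff ℝ 0 (deriv γ) := hγ.deriv'
  have hγ0 : ContDiff ℝ 0 γ := hγ.of_le (by norm_num)
  have hPc : Continuous fun u => det2 (γ u) (deriv γ u) := (hγ0.det2 hγ').continuous
  have h := integral_eq_sub_of_hasDerivAt (a := a) (b := b)
    (f := fun v => (∫ u in (0:ℝ)..v, det2 (γ u) (deriv γ u)) - det2 (γ a) (γ v))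
    (f' := fun v => det2 (γ v - γ a) (deriv γ v)) (fun v _ => by
      refine ((hPc.integral_hasStrictDerivAt 0 v).hasDerivAt.sub
        ((hasDerivAt_const v (γ a)).det2 (dγ v))).congr_deriv ?_
      simp only [det2, PiLp.sub_apply, PiLp.zero_apply]
      ring)
    (((hγ0.sub contDiff_const).det2 hγ').continuous.intervalIntegrable _ _)
  rw [h]
  simp only [det2]
  ring

/-- The first moment of the segment cut off by a chord, in terms of primitives. -/
theorem integral_det2_smul_sub {γ : ℝ → R2} (hγ : ContDiff ℝ 1 γ) (a b : ℝ) :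
    ∫ u in a..b, det2 (γ u - γ a) (deriv γ u) • (γ u - γ a) =
      (∫ u in (0:ℝ)..b, det2 (γ u) (deriv γ u) • γ u) -
        (∫ u in (0:ℝ)..a, det2 (γ u) (deriv γ u) • γ u) -
        (3/2 * ∫ u in a..b, det2 (γ u - γ a) (deriv γ u)) • γ a -
        (1/2 * det2 (γ a) (γ b)) • (γ a + γ b) := by
  have dγ (s) : HasDerivAt γ (deriv γ s) s := (hγ.differentiable (by norm_num) s).hasDerivAt
  have hγ' : ContDiff ℝ 0 (deriv γ) := hγ.deriv'
  have hγ0 : ContDiff ℝ 0 γ := hγ.of_le (by norm_num)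
  have hPc : Continuous fun u => det2 (γ u) (deriv γ u) := (hγ0.det2 hγ').continuous
  have hQc : Continuous fun u => det2 (γ u) (deriv γ u) • γ u := hPc.smul hγ0.continuous
  have hdet (v : ℝ) : HasDerivAt (fun v => det2 (γ a) (γ v)) (det2 (γ a) (deriv γ v)) v :=
    ((hasDerivAt_const v (γ a)).det2 (dγ v)).congr_deriv (by simp [det2])
  have h := integral_eq_sub_of_hasDerivAt (a := a) (b := b)
    (f := fun v => (∫ u in (0:ℝ)..v, det2 (γ u) (deriv γ u) • γ u) -
      (3/2 * ∫ u in (0:ℝ)..v, det2 (γ u) (deriv γ u)) • γ a -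
      (1/2 : ℝ) • (det2 (γ a) (γ v) • γ v) + det2 (γ a) (γ v) • γ a)
    (f' := fun v => det2 (γ v - γ a) (deriv γ v) • (γ v - γ a)) (fun v _ => by
      refine ((((hQc.integral_hasStrictDerivAt 0 v).hasDerivAt.sub
        (((hPc.integral_hasStrictDerivAt 0 v).hasDerivAt.const_mul (3/2)).smul_const _)).sub
        (((hdet v).smul (dγ v)).const_smul (1/2 : ℝ))).add
        ((hdet v).smul_const _)).congr_deriv ?_
      ext i
      fin_cases i <;>
      · simp [det2]
        ring)
    ((((hγ0.sub contDiff_const).det2 hγ').smul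
      (hγ0.sub contDiff_const)).continuous.intervalIntegrable _ _)
  rw [h, integral_det2_sub_deriv hγ]
  ext i
  simp only [det2, PiLp.add_apply, PiLp.sub_apply, PiLp.smul_apply, smul_eq_mul]
  ring

section Flotation

variable {γ : ℝ → R2} {t : ℝ → ℝ} {δ : ℝ}

/-- The speed of the second endpoint of a chord cutting off constant area. -/
theorem deriv_mul_det2_of_integral_eq_const (hγ : ContDiff ℝ 1 γ) (ht : Differentiable ℝ t)
    (hA : ∀ s, (1/2) * ∫ u in s..t s, det2 (γ u - γ s) (deriv γ u) = δ) (s : ℝ) :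
    deriv t s * det2 (γ (t s) - γ s) (deriv γ (t s)) = det2 (deriv γ s) (γ (t s) - γ s) := by
  have dγ (s) : HasDerivAt γ (deriv γ s) s := (hγ.differentiable (by norm_num) s).hasDerivAt
  have hγ' : ContDiff ℝ 0 (deriv γ) := hγ.deriv'
  have hγ0 : ContDiff ℝ 0 γ := hγ.of_le (by norm_num)
  have hPc : Continuous fun u => det2 (γ u) (deriv γ u) := (hγ0.det2 hγ').continuous
  have dP (v) := (hPc.integral_hasStrictDerivAt 0 v).hasDerivAt
  have dt := (ht s).hasDerivAt
  have h := (((dP (t s)).comp s dt).sub (dP s)).sub ((dγ s).det2 ((dγ (t s)).scomp s dt))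
  have hconst : HasDerivAt (fun _ : ℝ => 2 * δ) 0 s := hasDerivAt_const s _
  have heq := h.unique (hconst.congr_of_eventuallyEq (Filter.Eventually.of_forall fun v => by
    have h1 := hA v
    rw [integral_det2_sub_deriv hγ] at h1
    simp only [Pi.sub_apply, Function.comp_apply]
    linarith))
  simp only [det2, PiLp.sub_apply, PiLp.smul_apply, smul_eq_mul, Function.comp_apply] at heq ⊢
  linear_combination heq

theorem deriv_buoyCurve (hγ : ContDiff ℝ 1 γ) (ht : Differentiable ℝ t) (hδ : δ ≠ 0)
    (hA : ∀ s, (1/2) * ∫ u in s..t s, det2 (γ u - γ s) (deriv γ u) = δ) :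
    deriv (buoyCurve γ t δ) =
      fun s => (det2 (deriv γ s) (γ (t s) - γ s) / (6 * δ)) • (γ (t s) - γ s) := by
  funext s
  have dγ (s) : HasDerivAt γ (deriv γ s) s := (hγ.differentiable (by norm_num) s).hasDerivAt
  have hγ' : ContDiff ℝ 0 (deriv γ) := hγ.deriv'
  have hγ0 : ContDiff ℝ 0 γ := hγ.of_le (by norm_num)
  have hQc : Continuous fun u => det2 (γ u) (deriv γ u) • γ u :=
    ((hγ0.det2 hγ').smul hγ0).continuous
  have dQ (v) := (hQc.integral_hasStrictDerivAt 0 v).hasDerivAt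
  have dt := (ht s).hasDerivAt
  have dh := (dγ (t s)).scomp s dt
  have hbuoy : buoyCurve γ t δ = fun s => (1 / (3 * δ)) •
      ((∫ u in (0:ℝ)..t s, det2 (γ u) (deriv γ u) • γ u) -
        (∫ u in (0:ℝ)..s, det2 (γ u) (deriv γ u) • γ u) -
        (1/2 : ℝ) • (det2 (γ s) (γ (t s)) • (γ s + γ (t s)))) := by
    funext s
    have hs : 3/2 * ∫ u in s..t s, det2 (γ u - γ s) (deriv γ u) = 3 * δ := by
      linarith [hA s]
    rw [buoyCurve, integral_det2_smul_sub hγ, hs]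
    ext i
    simp only [PiLp.add_apply, PiLp.sub_apply, PiLp.smul_apply, smul_eq_mul]
    field_simp
    ring
  have hspeed := deriv_mul_det2_of_integral_eq_const hγ ht hA s
  have h := ((((dQ (t s)).scomp s dt).sub (dQ s)).sub
    ((((dγ s).det2 dh).smul ((dγ s).add dh)).const_smul (1/2 : ℝ))).const_smul (1 / (3 * δ))
  rw [hbuoy]
  refine h.deriv.trans ?_
  ext i
  simp only [det2, PiLp.add_apply, PiLp.sub_apply, PiLp.smul_apply, smul_eq_mul,
    Function.comp_apply] at hspeed ⊢
  field_simp
  fin_cases i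
  · simp
    linear_combination (12 * γ (t s) 0 + 6 * γ s 0) * hspeed
  · simp
    linear_combination (12 * γ (t s) 1 + 6 * γ s 1) * hspeed

end Flotation

/-- the affine normal of the buoyancy curve is parallel to the affine
bisector of the chord of flotation. -/
theorem stmt13
    (γ : ℝ → R2) (L : ℝ) (hL : 0 < L)
    (hγ : ContDiff ℝ 3 γ)
    (hper : ∀ s, γ (s + L) = γ s)
    (hreg : ∀ s, deriv γ s ≠ 0)
    (hinj : Set.InjOn γ (Set.Ico 0 L))
    (hor : 0 < ∫ s in (0:ℝ)..L, det2 (γ s) (deriv γ s))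
    (K : Set R2) (hKconv : Convex ℝ K) (hKcomp : IsCompact K)
    (hKint : (interior K).Nonempty) (hKbd : frontier K = Set.range γ)
    (δ : ℝ) (hδ0 : 0 < δ) (hδK : δ < (volume K).toReal)
    (t : ℝ → ℝ) (ht : ContDiff ℝ 1 t)
    (htrange : ∀ s, s < t s ∧ t s < s + L)
    (hA : ∀ s, (1/2) * ∫ u in s..t s, det2 (γ u - γ s) (deriv γ u) = δ)
    (hc1 : ∀ s, det2 (γ (t s) - γ s) (deriv γ s) ≠ 0)
    (hc2 : ∀ s, det2 (γ (t s) - γ s) (deriv γ (t s)) ≠ 0)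
    (hpar : ∀ s, det2 (deriv γ s) (deriv γ (t s)) ≠ 0) :
    ∀ s : ℝ,
      (det2 (deriv (buoyCurve γ t δ) s) (deriv (deriv (buoyCurve γ t δ)) s) ^ (-(2:ℝ)/3)) •
          deriv (deriv (buoyCurve γ t δ)) s -
        ((1/3) *
            det2 (deriv (buoyCurve γ t δ) s) (deriv (deriv (buoyCurve γ t δ)) s) ^ (-(5:ℝ)/3) *
            det2 (deriv (buoyCurve γ t δ) s) (deriv (deriv (deriv (buoyCurve γ t δ))) s)) •
          deriv (buoyCurve γ t δ) s =
      (8 * ((3/2) * δ) ^ ((1:ℝ)/3) /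
          (-4 * det2 (γ (t s) - γ s) (deriv γ s) * det2 (γ (t s) - γ s) (deriv γ (t s)) /
            det2 (deriv γ s) (deriv γ (t s)))) •
        (flotCurve γ t s - tangentPole γ t s) := by
  have hγ1 : ContDiff ℝ 1 γ := hγ.of_le (by norm_num)
  have hγ2 : ContDiff ℝ 2 γ := hγ.of_le (by norm_num)
  have hγ' : ContDiff ℝ 2 (deriv γ) := hγ.deriv'
  have hγ'1 : ContDiff ℝ 1 (deriv γ) := hγ'.of_le (by norm_num)
  have htd : Differentiable ℝ t := ht.differentiable (by norm_num)
  have hspeed := deriv_mul_det2_of_integral_eq_const hγ1 htd hA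
  have ht2 : ContDiff ℝ 2 t := by
    have hdt : deriv t = fun s => det2 (deriv γ s) (γ (t s) - γ s) /
        det2 (γ (t s) - γ s) (deriv γ (t s)) :=
      funext fun s => (eq_div_iff (hc2 s)).2 (hspeed s)
    have hc : ContDiff ℝ 1 fun s => γ (t s) - γ s := (hγ1.comp ht).sub hγ1
    refine (contDiff_succ_iff_deriv (n := 1)).2 ⟨htd, by simp, ?_⟩
    rw [hdt]
    exact (hγ'1.det2 hc).div (hc.det2 (hγ'1.comp ht)) hc2
  have hc : ContDiff ℝ 2 fun s => γ (t s) - γ s := (hγ2.comp ht2).sub hγ2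
  have hpos (s : ℝ) : 0 < det2 (deriv γ s) (γ (t s) - γ s) := by
    refine lt_of_le_of_ne (det2_deriv_sub_nonneg_of_frontier_eq_range hL hγ1
      (by simpa using hper 0) hreg hor hKconv hKcomp.isClosed hKint hKbd s (t s)) fun h => hc1 s ?_
    simp only [det2] at h ⊢
    linarith
  have dc (s : ℝ) : deriv (fun s => γ (t s) - γ s) s = deriv t s • deriv γ (t s) - deriv γ s :=
    (((hγ1.differentiable (by norm_num) (t s)).hasDerivAt.scomp s (htd s).hasDerivAt).sub
      (hγ1.differentiable (by norm_num) s).hasDerivAt).deriv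
  intro s
  rw [affine_second_deriv_of_deriv_eq_smul (κ := 12 * δ) (by positivity)
    (fun s => div_pos (hpos s) (by positivity)) ((hγ'.det2 hc).div_const _) hc
    (deriv_buoyCurve hγ1 htd hδ0.ne' hA) (fun s => ?_) s, dc]
  · have hpow : ((3/2) * δ) ^ ((1:ℝ)/3) = (12 * δ) ^ (-(2:ℝ)/3) * (6 * δ) := by
      have h8 : ((8:ℝ)⁻¹) ^ ((1:ℝ)/3) = 1/2 := by
        rw [show (8:ℝ)⁻¹ = (1/2) ^ (3:ℝ) by norm_num, ← Real.rpow_mul (by norm_num)]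
        norm_num
      rw [show (3/2) * δ = 8⁻¹ * (12 * δ) by ring, Real.mul_rpow (by norm_num) (by positivity), h8,
        show (1:ℝ)/3 = -(2:ℝ)/3 + 1 by norm_num, Real.rpow_add_one (by positivity)]
      ring
    have hp := (hpos s).ne'
    have hq := hc2 s
    have hw := hpar s
    have hp' : det2 (γ (t s) - γ s) (deriv γ s) = -det2 (deriv γ s) (γ (t s) - γ s) := by
      simp only [det2]
      ring
    have hdt : deriv t s = det2 (deriv γ s) (γ (t s) - γ s) /
        det2 (γ (t s) - γ s) (deriv γ (t s)) := (eq_div_iff hq).2 (hspeed s)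
    have hcramer (i : Fin 2) : det2 (deriv γ s) (deriv γ (t s)) * (γ (t s) i - γ s i) =
        det2 (γ (t s) - γ s) (deriv γ (t s)) * deriv γ s i +
          det2 (deriv γ s) (γ (t s) - γ s) * deriv γ (t s) i := by
      fin_cases i <;>
      · simp [det2]
        ring
    rw [hpow, hp', hdt, flotCurve, tangentPole]
    ext i
    have hi := hcramer i
    simp only [PiLp.add_apply, PiLp.sub_apply, PiLp.smul_apply, smul_eq_mul]
    generalize (12 * δ) ^ (-(2:ℝ)/3) = κ
    generalize det2 (deriv γ s) (γ (t s) - γ s) = p at *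
    generalize det2 (γ (t s) - γ s) (deriv γ (t s)) = q at *
    generalize det2 (deriv γ s) (deriv γ (t s)) = w at *
    field_simp
    linear_combination (-8 * κ) * hi
  · have h := hspeed s
    rw [dc]
    field_simp
    simp only [det2, PiLp.sub_apply, PiLp.smul_apply, smul_eq_mul] at h ⊢
    linear_combination 6 * h
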